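/- Let the coin process X be a Markov chain induced by an irreducible transition matrix W on finite 𝒳 (with H^W(X) > 0), and let the target process Y be a Markov chain whose transition matrix is a direct sum V = ⊕_{ξ=1}^r V_ξ of irreducible matrices on classes 𝒴_ξ with weights w(ξ) = Pr(Y_1 ∈ 𝒴_ξ). Then the infimum achievable rates satisfy R*_int(X,Y) = R*(X,Y) = (1/H^W(X)) · max{H^{V_ξ}(Y) : 1 ≤ ξ ≤ r, w(ξ) > 0}. -/

import Mathlib

open MeasureTheory Filter
open scoped ENNReal Classical

noncomputable section

namespace RNG

variable {𝒳 𝒴 : Type*}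

/-- The length-`m` prefix of an infinite sequence, as a tuple. -/
def pre (ω : ℕ → 𝒳) (m : ℕ) : Fin m → 𝒳 := fun i => ω i

/-- The length-`m` prefix of an infinite sequence, as a list. -/
def preL (ω : ℕ → 𝒳) (m : ℕ) : List 𝒳 := (List.range m).map ω

/-- `P_{X^m}(x^m)` : the probability of the cylinder set of a finite string `x^m`,
for a process with law `μ`. -/
def cylP [MeasurableSpace 𝒳] (μ : Measure (ℕ → 𝒳)) {m : ℕ} (x : Fin m → 𝒳) : ℝ :=
  (μ {ω | ∀ i : Fin m, ω i = x i}).toReal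

/-- Validity (exact generation) of an algorithm `φ` (given as a full-tree function on finite
coin strings, `none` playing the role of `⊥`): for every target value `y`, the probability
that the algorithm terminates with output `y` equals `PY y`. -/
def Valid {B : Type*} [MeasurableSpace 𝒳] (μ : Measure (ℕ → 𝒳)) (PY : B → ℝ)
    (φ : List 𝒳 → Option B) : Prop :=
  ∀ y : B,
    (μ {ω | ∃ i : ℕ, φ (preL ω i) = some y ∧ ∀ j < i, φ (preL ω j) = none}).toReal = PY y

/-- Strict lexicographic order on strings. -/
def lexLt [LT 𝒳] {m : ℕ} (x' x : Fin m → 𝒳) : Prop :=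
  ∃ i : Fin m, (∀ j : Fin m, j < i → x' j = x j) ∧ x' i < x i

/-- The subinterval of `[0,1)` assigned to the string `x` by the interval algorithm:
strings are arranged in lexicographic order, `x` receiving an interval of length `P x`. -/
def itv [LT 𝒳] [Fintype 𝒳] {m : ℕ} (P : (Fin m → 𝒳) → ℝ) (x : Fin m → 𝒳) : Set ℝ :=
  Set.Ico (∑ x' ∈ Finset.univ.filter (fun x' => lexLt x' x), P x')
    ((∑ x' ∈ Finset.univ.filter (fun x' => lexLt x' x), P x') + P x)

/-- The interval algorithm generating `Y^n` (target law `ν`) from the coin process `μ`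
has stopped after at most `m` coin symbols on the sample `ω`, i.e. the coin interval
`I_{x^m}` is contained in some target interval `J_{y^n}`. -/
def IntStopped [LinearOrder 𝒳] [Fintype 𝒳] [LinearOrder 𝒴] [Fintype 𝒴]
    [MeasurableSpace 𝒳] [MeasurableSpace 𝒴]
    (μ : Measure (ℕ → 𝒳)) (ν : Measure (ℕ → 𝒴)) (n m : ℕ) (ω : ℕ → 𝒳) : Prop :=
  ∃ y : Fin n → 𝒴, itv (fun x : Fin m → 𝒳 => cylP μ x) (pre ω m)
      ⊆ itv (fun y' : Fin n → 𝒴 => cylP ν y') y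

/-- A rate `R` is achievable by the interval algorithm:
`Pr(T_n > nR) → 0` (the stopping time `T_n` is `ℕ`-valued, so `T_n > nR ↔ T_n > ⌊nR⌋`). -/
def IntAchievable [LinearOrder 𝒳] [Fintype 𝒳] [LinearOrder 𝒴] [Fintype 𝒴]
    [MeasurableSpace 𝒳] [MeasurableSpace 𝒴]
    (μ : Measure (ℕ → 𝒳)) (ν : Measure (ℕ → 𝒴)) (R : ℝ) : Prop :=
  0 ≤ R ∧ Tendsto (fun n : ℕ =>
      (μ {ω | ¬ IntStopped μ ν n ⌊(n : ℝ) * R⌋₊ ω}).toReal) atTop (nhds 0)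

/-- `R⋆_int(X,Y)` : the infimum rate achievable by the interval algorithm. -/
def Rint [LinearOrder 𝒳] [Fintype 𝒳] [LinearOrder 𝒴] [Fintype 𝒴]
    [MeasurableSpace 𝒳] [MeasurableSpace 𝒴]
    (μ : Measure (ℕ → 𝒳)) (ν : Measure (ℕ → 𝒴)) : ℝ :=
  sInf {R : ℝ | IntAchievable μ ν R}

/-- A rate `R` is achievable by some sequence of valid algorithms: for each `n` there is a
valid algorithm `φ n` generating `Y^n` and `Pr(T_n > nR) → 0`. -/
def Achievable [MeasurableSpace 𝒳] [MeasurableSpace 𝒴]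
    (μ : Measure (ℕ → 𝒳)) (ν : Measure (ℕ → 𝒴)) (R : ℝ) : Prop :=
  0 ≤ R ∧ ∃ φ : (n : ℕ) → List 𝒳 → Option (Fin n → 𝒴),
    (∀ n : ℕ, Valid μ (fun y : Fin n → 𝒴 => cylP ν y) (φ n)) ∧
    Tendsto (fun n : ℕ =>
      (μ {ω | ∀ i ≤ ⌊(n : ℝ) * R⌋₊, φ n (preL ω i) = none}).toReal) atTop (nhds 0)

/-- `R⋆(X,Y)` : the infimum rate achievable over all valid algorithms. -/
def Rstar [MeasurableSpace 𝒳] [MeasurableSpace 𝒴]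
    (μ : Measure (ℕ → 𝒳)) (ν : Measure (ℕ → 𝒴)) : ℝ :=
  sInf {R : ℝ | Achievable μ ν R}

/-- The expected stopping time `E[T_n]` of the interval algorithm, via `E[T] = ∑_m Pr(T>m)`. -/
def intAvgT [LinearOrder 𝒳] [Fintype 𝒳] [LinearOrder 𝒴] [Fintype 𝒴]
    [MeasurableSpace 𝒳] [MeasurableSpace 𝒴]
    (μ : Measure (ℕ → 𝒳)) (ν : Measure (ℕ → 𝒴)) (n : ℕ) : ℝ≥0∞ :=
  ∑' m : ℕ, μ {ω | ¬ IntStopped μ ν n m ω}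

/-- A rate `L` is average achievable by the interval algorithm: `limsup E[T_n]/n ≤ L`. -/
def IntAvgAchievable [LinearOrder 𝒳] [Fintype 𝒳] [LinearOrder 𝒴] [Fintype 𝒴]
    [MeasurableSpace 𝒳] [MeasurableSpace 𝒴]
    (μ : Measure (ℕ → 𝒳)) (ν : Measure (ℕ → 𝒴)) (L : ℝ≥0∞) : Prop :=
  limsup (fun n : ℕ => intAvgT μ ν n / (n : ℝ≥0∞)) atTop ≤ L

/-- `L⋆_int(X,Y)` : the infimum average achievable rate of the interval algorithm. -/
def Lint [LinearOrder 𝒳] [Fintype 𝒳] [LinearOrder 𝒴] [Fintype 𝒴]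
    [MeasurableSpace 𝒳] [MeasurableSpace 𝒴]
    (μ : Measure (ℕ → 𝒳)) (ν : Measure (ℕ → 𝒴)) : ℝ≥0∞ :=
  sInf {L : ℝ≥0∞ | IntAvgAchievable μ ν L}

/-- A rate `L` is average achievable by some sequence of valid algorithms. -/
def AvgAchievable [MeasurableSpace 𝒳] [MeasurableSpace 𝒴]
    (μ : Measure (ℕ → 𝒳)) (ν : Measure (ℕ → 𝒴)) (L : ℝ≥0∞) : Prop :=
  ∃ φ : (n : ℕ) → List 𝒳 → Option (Fin n → 𝒴),
    (∀ n : ℕ, Valid μ (fun y : Fin n → 𝒴 => cylP ν y) (φ n)) ∧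
    limsup (fun n : ℕ =>
      (∑' m : ℕ, μ {ω | ∀ i ≤ m, φ n (preL ω i) = none}) / (n : ℝ≥0∞)) atTop ≤ L

/-- `L⋆(X,Y)` : the infimum average achievable rate over all valid algorithms. -/
def Lstar [MeasurableSpace 𝒳] [MeasurableSpace 𝒴]
    (μ : Measure (ℕ → 𝒳)) (ν : Measure (ℕ → 𝒴)) : ℝ≥0∞ :=
  sInf {L : ℝ≥0∞ | AvgAchievable μ ν L}

/-- The spectral sup-entropy `H̄(X)`: the event `(1/m) log(1/P_{X^m}(X^m)) ≥ λ` is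
`P_{X^m}(X^m) ≤ 2^{-mλ}`. -/
def specSup [MeasurableSpace 𝒳] (μ : Measure (ℕ → 𝒳)) : ℝ :=
  sInf {lam : ℝ | Tendsto (fun m : ℕ =>
    (μ {ω | cylP μ (pre ω m) ≤ (2 : ℝ) ^ (-((m : ℝ) * lam))}).toReal) atTop (nhds 0)}

/-- The spectral inf-entropy `H̲(X)`: the event `(1/m) log(1/P_{X^m}(X^m)) ≤ λ` is
`P_{X^m}(X^m) ≥ 2^{-mλ}`. -/
def specInf [MeasurableSpace 𝒳] (μ : Measure (ℕ → 𝒳)) : ℝ :=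
  sSup {lam : ℝ | Tendsto (fun m : ℕ =>
    (μ {ω | (2 : ℝ) ^ (-((m : ℝ) * lam)) ≤ cylP μ (pre ω m)}).toReal) atTop (nhds 0)}

/-- The (sup-)entropy rate `H(X) = limsup (1/m) H(X^m)`. -/
def entRate [MeasurableSpace 𝒳] [Fintype 𝒳] (μ : Measure (ℕ → 𝒳)) : ℝ :=
  limsup (fun m : ℕ =>
    (∑ x : Fin m → 𝒳, cylP μ x * Real.logb 2 (1 / cylP μ x)) / (m : ℝ)) atTop

/-- Upper-tail condition: `Pr((1/m) log(1/P_{X^m}(X^m)) ≥ H̄(X)+δ) ≤ K/m²` eventually. -/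
def UpperTail [MeasurableSpace 𝒳] (μ : Measure (ℕ → 𝒳)) : Prop :=
  ∀ δ : ℝ, 0 < δ → ∃ (K : ℝ) (m₀ : ℕ), ∀ m : ℕ, m₀ ≤ m →
    (μ {ω | cylP μ (pre ω m) ≤ (2 : ℝ) ^ (-((m : ℝ) * (specSup μ + δ)))}).toReal
      ≤ K / (m : ℝ) ^ 2

/-- Lower-tail condition: `Pr((1/m) log(1/P_{X^m}(X^m)) ≤ H̲(X)−δ) ≤ K/m²` eventually. -/
def LowerTail [MeasurableSpace 𝒳] (μ : Measure (ℕ → 𝒳)) : Prop :=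
  ∀ δ : ℝ, 0 < δ → ∃ (K : ℝ) (m₀ : ℕ), ∀ m : ℕ, m₀ ≤ m →
    (μ {ω | (2 : ℝ) ^ (-((m : ℝ) * (specInf μ - δ))) ≤ cylP μ (pre ω m)}).toReal
      ≤ K / (m : ℝ) ^ 2

/-- The finite-dimensional distributions of a Markov chain with initial distribution `q`
and transition matrix `W` (`W x x'` is the transition probability from `x` to `x'`). -/
def markovP (q : 𝒳 → ℝ) (W : 𝒳 → 𝒳 → ℝ) : (m : ℕ) → (Fin m → 𝒳) → ℝ
  | 0, _ => 1
  | m + 1, x => q (x 0) * ∏ i : Fin m, W (x i.castSucc) (x i.succ)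

/-- `μ` is the law of the Markov chain with initial distribution `q` and transition matrix `W`. -/
def IsMarkovMeasure [MeasurableSpace 𝒳] (μ : Measure (ℕ → 𝒳)) (q : 𝒳 → ℝ)
    (W : 𝒳 → 𝒳 → ℝ) : Prop :=
  ∀ (m : ℕ) (x : Fin m → 𝒳), cylP μ x = markovP q W m x

/-- `W` is a (row-)stochastic transition matrix. -/
def IsTransMat [Fintype 𝒳] (W : 𝒳 → 𝒳 → ℝ) : Prop :=
  (∀ x x', 0 ≤ W x x') ∧ ∀ x, ∑ x', W x x' = 1

/-- Irreducibility: any state reaches any other in some `k ≥ 1` steps. -/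
def IrreducibleMat [Fintype 𝒳] [DecidableEq 𝒳] (W : Matrix 𝒳 𝒳 ℝ) : Prop :=
  ∀ x x' : 𝒳, ∃ k : ℕ, 1 ≤ k ∧ 0 < (W ^ k) x x'

/-- `π` is a stationary distribution of `W`. -/
def IsStationary [Fintype 𝒳] (π : 𝒳 → ℝ) (W : 𝒳 → 𝒳 → ℝ) : Prop :=
  (∀ x, 0 ≤ π x) ∧ (∑ x, π x = 1) ∧ ∀ x, ∑ x', π x' * W x' x = π x

/-- `q` is a probability distribution (initial distribution). -/
def IsInitial [Fintype 𝒳] (q : 𝒳 → ℝ) : Prop :=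
  (∀ x, 0 ≤ q x) ∧ ∑ x, q x = 1

/-- The entropy rate `H^W(X) = Σ_{x',x} π(x') W(x|x') log (1/W(x|x'))` of a stationary
Markov chain. -/
def matEnt [Fintype 𝒳] (π : 𝒳 → ℝ) (W : 𝒳 → 𝒳 → ℝ) : ℝ :=
  ∑ x' : 𝒳, ∑ x : 𝒳, π x' * W x' x * Real.logb 2 (1 / W x' x)

/-- The weight `w(ξ) = Pr(Y_1 ∈ 𝒴_ξ)` of the irreducible class `ξ` under the initial
distribution `q`, where `c` assigns to each state its class. -/
def wgt [Fintype 𝒴] {r : ℕ} (c : 𝒴 → Fin r) (q : 𝒴 → ℝ) (ξ : Fin r) : ℝ :=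
  ∑ y ∈ Finset.univ.filter (fun y => c y = ξ), q y

/-- The binary entropy function (base 2). -/
def binEnt (t : ℝ) : ℝ := t * Real.logb 2 (1 / t) + (1 - t) * Real.logb 2 (1 / (1 - t))

end RNG

open RNG

open RNG

set_option linter.unusedSectionVars false

namespace RNG

section Prefix

variable {𝒳 : Type*} [Fintype 𝒳] [MeasurableSpace 𝒳] [DiscreteMeasurableSpace 𝒳]

theorem measurable_pre (m : ℕ) : Measurable fun ω : ℕ → 𝒳 => pre ω m :=
  measurable_pi_lambda _ fun i => measurable_pi_apply (i : ℕ)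

theorem measurableSet_pre {m : ℕ} (A : (Fin m → 𝒳) → Prop) :
    MeasurableSet {ω : ℕ → 𝒳 | A (pre ω m)} :=
  measurable_pre m (Set.toFinite {x | A x}).measurableSet

theorem cylP_eq (μ : Measure (ℕ → 𝒳)) {m : ℕ} (x : Fin m → 𝒳) :
    cylP μ x = μ.real {ω | pre ω m = x} := by
  simp only [cylP, Measure.real, pre, funext_iff]

theorem cylP_nonneg (μ : Measure (ℕ → 𝒳)) {m : ℕ} (x : Fin m → 𝒳) : 0 ≤ cylP μ x :=
  ENNReal.toReal_nonneg

theorem measureReal_pre (μ : Measure (ℕ → 𝒳)) [IsProbabilityMeasure μ] {m : ℕ}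
    {A : (Fin m → 𝒳) → Prop} {s : Finset (Fin m → 𝒳)} (hs : ∀ x, x ∈ s ↔ A x) :
    μ.real {ω | A (pre ω m)} = ∑ x ∈ s, cylP μ x := by
  have h := sum_measureReal_preimage_singleton (μ := μ) s
    (f := fun ω : ℕ → 𝒳 => pre ω m)
    (fun y _ => measurable_pre m (Set.toFinite {y}).measurableSet)
  simp only [cylP_eq]
  refine Eq.trans ?_ h.symm
  congr 1
  ext ω; simp [hs]

theorem sum_cylP (μ : Measure (ℕ → 𝒳)) [IsProbabilityMeasure μ] (m : ℕ) :
    ∑ x : Fin m → 𝒳, cylP μ x = 1 := by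
  have h := measureReal_pre μ (m := m) (A := fun _ => True) (s := Finset.univ) (by simp)
  simpa using h.symm

theorem measureReal_cylP_eq_zero (μ : Measure (ℕ → 𝒳)) [IsProbabilityMeasure μ] (m : ℕ) :
    μ.real {ω | cylP μ (pre ω m) = 0} = 0 := by
  rw [measureReal_pre μ (A := fun x => cylP μ x = 0) (s := {x | cylP μ x = 0}) (by simp)]
  exact Finset.sum_eq_zero fun x hx => (Finset.mem_filter.1 hx).2

end Prefix

section Interval

variable {𝒳 : Type*} [Fintype 𝒳] [LinearOrder 𝒳] [MeasurableSpace 𝒳]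
  [DiscreteMeasurableSpace 𝒳]

theorem lexLt_trichotomy {m : ℕ} {x x' : Fin m → 𝒳} (h : x ≠ x') :
    lexLt x x' ∨ lexLt x' x := by
  obtain ⟨i, hi⟩ := Function.ne_iff.1 h
  obtain ⟨j, hj, hmin⟩ := WellFounded.has_min (wellFounded_lt (α := Fin m))
    {i | x i ≠ x' i} ⟨i, hi⟩
  have he : ∀ k < j, x k = x' k := fun k hk => by
    by_contra hne
    exact hmin k hne hk
  rcases lt_or_gt_of_ne (show x j ≠ x' j from hj) with h1 | h1
  · exact Or.inl ⟨j, he, h1⟩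
  · exact Or.inr ⟨j, fun k hk => (he k hk).symm, h1⟩

theorem lexLt_trans {m : ℕ} {x y z : Fin m → 𝒳} (h1 : lexLt x y) (h2 : lexLt y z) :
    lexLt x z := by
  obtain ⟨i, hi, hi'⟩ := h1
  obtain ⟨j, hj, hj'⟩ := h2
  rcases lt_trichotomy i j with h | h | h
  · exact ⟨i, fun k hk => (hi k hk).trans (hj k (hk.trans h)), (hj i h) ▸ hi'⟩
  · subst h
    exact ⟨i, fun k hk => (hi k hk).trans (hj k hk), hi'.trans hj'⟩
  · exact ⟨j, fun k hk => (hi k (hk.trans h)).trans (hj k hk), (hi j h) ▸ hj'⟩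

theorem lexLt_irrefl {m : ℕ} (x : Fin m → 𝒳) : ¬ lexLt x x := fun ⟨_, _, h⟩ => lt_irrefl _ h

/-- Lower endpoint of the interval attached to `x`. -/
def itvLo (μ : Measure (ℕ → 𝒳)) {m : ℕ} (x : Fin m → 𝒳) : ℝ :=
  μ.real {ω | lexLt (pre ω m) x}

/-- Upper endpoint of the interval attached to `x`. -/
def itvHi (μ : Measure (ℕ → 𝒳)) {m : ℕ} (x : Fin m → 𝒳) : ℝ :=
  μ.real {ω | lexLt (pre ω m) x ∨ pre ω m = x}

variable (μ : Measure (ℕ → 𝒳)) [IsProbabilityMeasure μ]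

theorem itvHi_eq {m : ℕ} (x : Fin m → 𝒳) : itvHi μ x = itvLo μ x + cylP μ x := by
  rw [itvHi, itvLo, cylP_eq, ← measureReal_union]
  · rfl
  · rw [Set.disjoint_left]
    intro ω h1 h2
    have h2' : pre ω m = x := h2
    have h1' : lexLt (pre ω m) x := h1
    rw [h2'] at h1'
    exact lexLt_irrefl x h1'
  · exact measurableSet_pre (fun z => z = x)

theorem itv_eq {m : ℕ} (x : Fin m → 𝒳) :
    itv (fun x : Fin m → 𝒳 => cylP μ x) x = Set.Ico (itvLo μ x) (itvHi μ x) := by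
  rw [itvHi_eq, itv, itvLo, measureReal_pre μ (A := fun z => lexLt z x)
    (s := Finset.univ.filter fun z => lexLt z x) (by simp)]

theorem itvLo_nonneg {m : ℕ} (x : Fin m → 𝒳) : 0 ≤ itvLo μ x := measureReal_nonneg

theorem itvHi_le_one {m : ℕ} (x : Fin m → 𝒳) : itvHi μ x ≤ 1 := measureReal_le_one

theorem itvHi_le_itvLo {m : ℕ} {x x' : Fin m → 𝒳} (h : lexLt x x') :
    itvHi μ x ≤ itvLo μ x' := by
  refine measureReal_mono ?_
  rintro ω (h1 | h1)
  · exact lexLt_trans h1 h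
  · show lexLt (pre ω m) x'
    rw [h1]; exact h

theorem itv_disjoint {m : ℕ} {x x' : Fin m → 𝒳} (h : x ≠ x') :
    Disjoint (itv (fun x : Fin m → 𝒳 => cylP μ x) x)
      (itv (fun x : Fin m → 𝒳 => cylP μ x) x') := by
  rw [itv_eq, itv_eq, Set.disjoint_left]
  rintro t ⟨h1, h2⟩ ⟨h3, h4⟩
  rcases lexLt_trichotomy h with h | h <;> have := itvHi_le_itvLo μ h <;> linarith

theorem itv_pre_subset (ω : ℕ → 𝒳) {i m : ℕ} (h : i ≤ m) :
    itv (fun x : Fin m → 𝒳 => cylP μ x) (pre ω m)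
      ⊆ itv (fun x : Fin i → 𝒳 => cylP μ x) (pre ω i) := by
  rw [itv_eq, itv_eq]
  apply Set.Ico_subset_Ico
  · refine measureReal_mono ?_
    rintro ω' ⟨j, hj, hj'⟩
    exact ⟨j.castLE h, fun k hk => hj ⟨k, lt_trans hk j.2⟩ hk, hj'⟩
  · refine measureReal_mono ?_
    rintro ω' (⟨j, hj, hj'⟩ | h1)
    · by_cases hji : (j : ℕ) < i
      · exact Or.inl ⟨⟨j, hji⟩, fun k hk => hj (k.castLE h) hk, hj'⟩
      · refine Or.inr (funext fun k => hj (k.castLE h) ?_)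
        have := k.2
        simp only [Fin.lt_def, Fin.val_castLE]
        omega
    · exact Or.inr (funext fun k => congrFun h1 (k.castLE h))

theorem measurableSet_itv {m : ℕ} (P : (Fin m → 𝒳) → ℝ) (x : Fin m → 𝒳) :
    MeasurableSet (itv P x) := measurableSet_Ico

theorem volume_itv_ne_top {m : ℕ} (P : (Fin m → 𝒳) → ℝ) (x : Fin m → 𝒳) :
    volume (itv P x) ≠ ⊤ := measure_Ico_lt_top.ne

theorem itv_subset_Ico {m : ℕ} (x : Fin m → 𝒳) :
    itv (fun x : Fin m → 𝒳 => cylP μ x) x ⊆ Set.Ico 0 1 := by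
  rw [itv_eq]
  exact Set.Ico_subset_Ico (itvLo_nonneg μ x) (itvHi_le_one μ x)

theorem volume_itv {m : ℕ} (x : Fin m → 𝒳) :
    volume.real (itv (fun x : Fin m → 𝒳 => cylP μ x) x) = cylP μ x := by
  have := cylP_nonneg μ x
  rw [itv, Real.volume_real_Ico_of_le (by linarith)]
  ring

theorem volume_iUnion_itv {m : ℕ} (s : Finset (Fin m → 𝒳)) :
    volume.real (⋃ x ∈ s, itv (fun x : Fin m → 𝒳 => cylP μ x) x) = ∑ x ∈ s, cylP μ x := by
  rw [measureReal_biUnion_finset ?_ ?_ fun x _ => volume_itv_ne_top _ x]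
  · exact Finset.sum_congr rfl fun x _ => volume_itv μ x
  · exact fun x _ y _ h => itv_disjoint μ h
  · exact fun x _ => measurableSet_itv _ x

theorem iUnion_itv_subset {m : ℕ} (s : Finset (Fin m → 𝒳)) :
    (⋃ x ∈ s, itv (fun x : Fin m → 𝒳 => cylP μ x) x) ⊆ Set.Ico 0 1 :=
  Set.iUnion₂_subset fun x _ => itv_subset_Ico μ x

variable {𝒴 : Type*} [Fintype 𝒴] [LinearOrder 𝒴] [MeasurableSpace 𝒴]
  [DiscreteMeasurableSpace 𝒴]

/-- The coin mass of strings whose interval lies inside a fixed target interval is at most the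
length of the target interval. -/
theorem measureReal_itv_subset_le (ν : Measure (ℕ → 𝒴)) [IsProbabilityMeasure ν] {n m : ℕ}
    (y : Fin n → 𝒴) :
    μ.real {ω | itv (fun x : Fin m → 𝒳 => cylP μ x) (pre ω m)
      ⊆ itv (fun y' : Fin n → 𝒴 => cylP ν y') y} ≤ cylP ν y := by
  rw [measureReal_pre μ (A := fun x => itv (fun x : Fin m → 𝒳 => cylP μ x) x
      ⊆ itv (fun y' : Fin n → 𝒴 => cylP ν y') y) (s := Finset.univ.filter _)
      fun x => Finset.mem_filter_univ x, ← volume_iUnion_itv, ← volume_itv ν y]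
  refine measureReal_mono (Set.iUnion₂_subset fun x hx => (Finset.mem_filter.1 hx).2) ?_
  exact measure_Ico_lt_top.ne

/-- Overflow estimate for the interval algorithm: unless the coin string is too likely or the
target string is too unlikely, failure to stop forces the coin interval to straddle an
endpoint of one of the at most `1 / b` long target intervals. -/
theorem measureReal_not_intStopped_le (ν : Measure (ℕ → 𝒴)) [IsProbabilityMeasure ν] (n m : ℕ)
    {a b : ℝ} (ha : 0 ≤ a) (hb : 0 < b) :
    μ.real {ω | ¬ IntStopped μ ν n m ω} ≤
      μ.real {ω | a < cylP μ (pre ω m)} + ν.real {ω | cylP ν (pre ω n) < b} + 2 * a / b := by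
  set I : (Fin m → 𝒳) → Set ℝ := itv (fun x : Fin m → 𝒳 => cylP μ x) with hI
  set J : (Fin n → 𝒴) → Set ℝ := itv (fun y : Fin n → 𝒴 => cylP ν y) with hJ
  set S : Finset (Fin m → 𝒳) :=
    Finset.univ.filter fun x => (¬ ∃ y, I x ⊆ J y) ∧ cylP μ x ≤ a with hS
  set L : Finset (Fin n → 𝒴) := Finset.univ.filter fun y => ¬ cylP ν y < b with hL
  have h1 : μ.real {ω | ¬ IntStopped μ ν n m ω} ≤
      μ.real {ω | a < cylP μ (pre ω m)} + ∑ x ∈ S, cylP μ x := by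
    rw [← measureReal_pre μ (A := fun x => (¬ ∃ y, I x ⊆ J y) ∧ cylP μ x ≤ a) (s := S)
      (by simp [hS])]
    refine le_trans (measureReal_mono ?_) (measureReal_union_le _ _)
    intro ω hω
    by_cases h : a < cylP μ (pre ω m)
    · exact Or.inl h
    · exact Or.inr ⟨hω, not_lt.1 h⟩
  have hLsum : ∑ y ∈ L, cylP ν y = 1 - ν.real {ω | cylP ν (pre ω n) < b} := by
    rw [measureReal_pre ν (A := fun y => cylP ν y < b) (s := {y | cylP ν y < b}) (by simp),
      ← sum_cylP ν n,
      ← Finset.sum_filter_add_sum_filter_not Finset.univ (fun y => cylP ν y < b)]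
    ring
  have hcard : (L.card : ℝ) * b ≤ 1 := by
    calc (L.card : ℝ) * b = ∑ y ∈ L, b := by simp
      _ ≤ ∑ y ∈ L, cylP ν y :=
        Finset.sum_le_sum fun y hy => not_lt.1 (Finset.mem_filter.1 hy).2
      _ ≤ 1 := by
        rw [hLsum]
        linarith [measureReal_nonneg (μ := ν) (s := {ω | cylP ν (pre ω n) < b})]
  set N : Set ℝ := Set.Ico 0 1 \ ⋃ y ∈ L, J y with hN
  set B : (Fin n → 𝒴) → Set ℝ := fun y =>
    Set.Ico (itvLo ν y) (itvLo ν y + a) ∪ Set.Ico (itvHi ν y - a) (itvHi ν y) with hB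
  have hsub : (⋃ x ∈ S, I x) ⊆ N ∪ ⋃ y ∈ L, B y := by
    intro t ht
    by_cases htN : t ∈ ⋃ y ∈ L, J y
    · right
      simp only [Set.mem_iUnion, exists_prop] at ht htN ⊢
      obtain ⟨x, hx, htx⟩ := ht
      obtain ⟨y, hy, hty⟩ := htN
      refine ⟨y, hy, ?_⟩
      obtain ⟨hx1, hx2⟩ := (Finset.mem_filter.1 hx).2
      have hns : ¬ I x ⊆ J y := fun h => hx1 ⟨y, h⟩
      rw [hI, itv_eq] at htx
      rw [hJ, itv_eq] at hty
      rw [hI, hJ, itv_eq, itv_eq] at hns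
      have hxx := itvHi_eq μ x
      obtain ⟨h2, h3⟩ := htx
      obtain ⟨h4, h5⟩ := hty
      by_cases h6 : itvLo ν y ≤ itvLo μ x
      · by_cases h7 : itvHi μ x ≤ itvHi ν y
        · exact absurd (Set.Ico_subset_Ico h6 h7) hns
        · right
          exact ⟨by linarith, h5⟩
      · left
        exact ⟨h4, by linarith⟩
    · left
      exact ⟨iUnion_itv_subset μ S ht, htN⟩
  have hNvol : volume.real N = ν.real {ω | cylP ν (pre ω n) < b} := by
    rw [hN, measureReal_sdiff (iUnion_itv_subset ν L)
      (Finset.measurableSet_biUnion _ fun y _ => measurableSet_itv _ y)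
      (measure_Ico_lt_top.ne), volume_iUnion_itv, hLsum,
      Real.volume_real_Ico_of_le zero_le_one]
    ring
  have hBvol : ∀ y, volume.real (B y) ≤ 2 * a := by
    intro y
    refine (measureReal_union_le _ _).trans ?_
    rw [Real.volume_real_Ico_of_le (by linarith), Real.volume_real_Ico_of_le (by linarith)]
    linarith
  have hfinN : volume N ≠ ⊤ := measure_ne_top_of_subset Set.sdiff_subset measure_Ico_lt_top.ne
  have hfinB : volume (⋃ y ∈ L, B y) ≠ ⊤ := by
    refine (measure_biUnion_lt_top L.finite_toSet fun y _ => ?_).ne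
    exact measure_union_lt_top measure_Ico_lt_top measure_Ico_lt_top
  have h2 : ∑ x ∈ S, cylP μ x ≤ ν.real {ω | cylP ν (pre ω n) < b} + 2 * a / b := by
    rw [← volume_iUnion_itv, ← hNvol]
    refine (measureReal_mono hsub (measure_union_ne_top hfinN hfinB)).trans ?_
    refine (measureReal_union_le _ _).trans ?_
    gcongr
    refine (measureReal_biUnion_finset_le _ _).trans ?_
    refine (Finset.sum_le_sum fun y _ => hBvol y).trans ?_
    rw [Finset.sum_const, nsmul_eq_mul, le_div_iff₀ hb]
    nlinarith
  linarith

end Interval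

section Algorithms

variable {𝒳 : Type*}

theorem preL_length (ω : ℕ → 𝒳) (m : ℕ) : (preL ω m).length = m := by simp [preL]

theorem preL_eq_of_pre_eq {ω ω' : ℕ → 𝒳} {m : ℕ} (h : pre ω m = pre ω' m) {i : ℕ}
    (hi : i ≤ m) : preL ω i = preL ω' i := by
  refine List.map_congr_left fun j hj => ?_
  have hj' := List.mem_range.1 hj
  exact congrFun h ⟨j, hj'.trans_le hi⟩

/-- View a function on tuples of every length as a function on lists. -/
def ofTuple {B : Type*} (G : (m : ℕ) → (Fin m → 𝒳) → B) (l : List 𝒳) : B := G l.length l.get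

theorem ofTuple_preL {B : Type*} (G : (m : ℕ) → (Fin m → 𝒳) → B) (ω : ℕ → 𝒳) (m : ℕ) :
    ofTuple G (preL ω m) = G m (pre ω m) := by
  have key : ∀ (l : List 𝒳) (k : ℕ) (h : l.length = k),
      G l.length l.get = G k fun i => l.get (i.cast h.symm) := by
    rintro l _ rfl
    rfl
  rw [ofTuple, key _ m (preL_length ω m)]
  congr 1
  funext i
  simp only [preL, pre, List.get_eq_getElem, List.getElem_map, List.getElem_range]
  rfl

/-- The event that the algorithm `φ` stops within `m` coin symbols with output `y`. -/
def outBy {B : Type*} (φ : List 𝒳 → Option B) (y : B) (m : ℕ) : Set (ℕ → 𝒳) :=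
  {ω | ∃ i ≤ m, φ (preL ω i) = some y ∧ ∀ j < i, φ (preL ω j) = none}

/-- The event that the algorithm `φ` stops with output `y`. -/
def out {B : Type*} (φ : List 𝒳 → Option B) (y : B) : Set (ℕ → 𝒳) :=
  {ω | ∃ i : ℕ, φ (preL ω i) = some y ∧ ∀ j < i, φ (preL ω j) = none}

variable {B : Type*} (φ : List 𝒳 → Option B)

theorem out_eq_iUnion (y : B) : out φ y = ⋃ m, outBy φ y m := by
  ext ω
  simp only [out, outBy, Set.mem_ofPred_eq, Set.mem_iUnion]
  constructor
  · rintro ⟨i, hi⟩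
    exact ⟨i, i, le_rfl, hi⟩
  · rintro ⟨_, i, _, hi⟩
    exact ⟨i, hi⟩

theorem outBy_mono (y : B) : Monotone (outBy φ y) := by
  rintro m m' h ω ⟨i, hi, hi'⟩
  exact ⟨i, hi.trans h, hi'⟩

theorem exists_mem_outBy {ω : ℕ → 𝒳} {m i : ℕ} (hi : i ≤ m) (h : φ (preL ω i) ≠ none) :
    ∃ y, ω ∈ outBy φ y m := by
  have hex : ∃ i, φ (preL ω i) ≠ none := ⟨i, h⟩
  obtain ⟨y, hy⟩ := Option.ne_none_iff_exists'.1 (Nat.find_spec hex)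
  exact ⟨y, Nat.find hex, (Nat.find_min' hex h).trans hi, hy,
    fun j hj => not_not.1 (Nat.find_min hex hj)⟩

theorem disjoint_out {y y' : B} (h : y ≠ y') : Disjoint (out φ y) (out φ y') := by
  rw [Set.disjoint_left]
  rintro ω ⟨i, hi, hi'⟩ ⟨j, hj, hj'⟩
  rcases lt_trichotomy i j with hij | hij | hij
  · rw [hj' i hij] at hi; cases hi
  · subst hij
    rw [hi] at hj
    exact h (Option.some.inj hj)
  · rw [hi' j hij] at hj; cases hj

variable [Fintype 𝒳] [MeasurableSpace 𝒳] [DiscreteMeasurableSpace 𝒳]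

theorem measurableSet_outBy (y : B) (m : ℕ) : MeasurableSet (outBy φ y m) := by
  have : outBy φ y m = {ω | ∃ ω' ∈ outBy φ y m, pre ω' m = pre ω m} := by
    ext ω
    refine ⟨fun h => ⟨ω, h, rfl⟩, ?_⟩
    rintro ⟨ω', ⟨i, hi, h1, h2⟩, h⟩
    refine ⟨i, hi, ?_, fun j hj => ?_⟩
    · rw [← preL_eq_of_pre_eq h hi]; exact h1
    · rw [← preL_eq_of_pre_eq h (hj.le.trans hi)]; exact h2 j hj
  rw [this]
  exact measurableSet_pre (fun x => ∃ ω' ∈ outBy φ y m, pre ω' m = x)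

theorem measurableSet_out (y : B) : MeasurableSet (out φ y) := by
  rw [out_eq_iUnion]
  exact MeasurableSet.iUnion fun m => measurableSet_outBy φ y m

theorem cylP_le_of_mem_outBy (μ : Measure (ℕ → 𝒳)) [IsProbabilityMeasure μ] {y : B} {m : ℕ}
    {ω : ℕ → 𝒳} (h : ω ∈ outBy φ y m) : cylP μ (pre ω m) ≤ μ.real (out φ y) := by
  rw [cylP_eq]
  refine measureReal_mono ?_
  intro ω' hω'
  obtain ⟨i, hi, h1, h2⟩ := h
  refine ⟨i, ?_, fun j hj => ?_⟩
  · rw [preL_eq_of_pre_eq hω' hi]; exact h1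
  · rw [preL_eq_of_pre_eq hω' (hj.le.trans hi)]; exact h2 j hj

/-- A valid algorithm cannot map likely coin strings to unlikely target strings. -/
theorem measureReal_cylP_le_of_valid {𝒴 : Type*} [Fintype 𝒴] [MeasurableSpace 𝒴]
    [DiscreteMeasurableSpace 𝒴] (μ : Measure (ℕ → 𝒳)) [IsProbabilityMeasure μ]
    (ν : Measure (ℕ → 𝒴)) [IsProbabilityMeasure ν] {n : ℕ} {φ : List 𝒳 → Option (Fin n → 𝒴)}
    (hφ : Valid μ (fun y : Fin n → 𝒴 => cylP ν y) φ) (m : ℕ) {s t : ℝ} (hts : t < s) :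
    ν.real {ω | cylP ν (pre ω n) ≤ t} ≤
      μ.real {ω | ∀ i ≤ m, φ (preL ω i) = none} + μ.real {ω | cylP μ (pre ω m) < s} := by
  have hout : ∀ y, μ.real (out φ y) = cylP ν y := hφ
  rw [measureReal_pre ν (A := fun y => cylP ν y ≤ t) (s := {y | cylP ν y ≤ t}) (by simp)]
  simp_rw [← hout]
  rw [← measureReal_biUnion_finset (fun y _ y' _ h => disjoint_out φ h)
    (fun y _ => measurableSet_out φ y)]
  refine (measureReal_mono ?_).trans (measureReal_union_le _ _)
  intro ω hω
  simp only [Set.mem_iUnion, Finset.mem_filter_univ, exists_prop] at hω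
  obtain ⟨y, hy, hωy⟩ := hω
  by_cases hs : cylP μ (pre ω m) < s
  · exact Or.inr hs
  left
  by_contra hne
  simp only [Set.mem_ofPred_eq, not_forall] at hne
  obtain ⟨i, hi, hi'⟩ := hne
  obtain ⟨y', hy'⟩ := exists_mem_outBy φ hi hi'
  have hyy : y' = y := by
    by_contra hne
    refine Set.disjoint_left.1 (disjoint_out φ hne) ?_ hωy
    rw [out_eq_iUnion]
    exact Set.mem_iUnion.2 ⟨m, hy'⟩
  subst hyy
  have := cylP_le_of_mem_outBy φ μ hy'
  linarith

end Algorithms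

section IntervalAlgorithm

variable {𝒳 𝒴 : Type*} [Fintype 𝒳] [LinearOrder 𝒳] [MeasurableSpace 𝒳]
  [DiscreteMeasurableSpace 𝒳] [Fintype 𝒴] [LinearOrder 𝒴] [MeasurableSpace 𝒴]
  [DiscreteMeasurableSpace 𝒴]

/-- The interval algorithm as a function on coin strings; null strings never stop. -/
def intAlg (μ : Measure (ℕ → 𝒳)) (ν : Measure (ℕ → 𝒴)) (n : ℕ) :
    List 𝒳 → Option (Fin n → 𝒴) :=
  ofTuple fun m x =>
    if h : ∃ y : Fin n → 𝒴, cylP μ x ≠ 0 ∧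
      itv (fun x : Fin m → 𝒳 => cylP μ x) x ⊆ itv (fun y' : Fin n → 𝒴 => cylP ν y') y
    then some h.choose else none

variable (μ : Measure (ℕ → 𝒳)) (ν : Measure (ℕ → 𝒴))
  {n m : ℕ} {ω : ℕ → 𝒳}

theorem itv_subset_of_intAlg_eq_some {y : Fin n → 𝒴} (h : intAlg μ ν n (preL ω m) = some y) :
    itv (fun x : Fin m → 𝒳 => cylP μ x) (pre ω m)
      ⊆ itv (fun y' : Fin n → 𝒴 => cylP ν y') y := by
  rw [intAlg, ofTuple_preL] at h
  split_ifs at h with h'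
  rw [← Option.some.inj h]
  exact h'.choose_spec.2

theorem not_intStopped_of_intAlg_eq_none (h : intAlg μ ν n (preL ω m) = none) :
    ¬ IntStopped μ ν n m ω ∨ cylP μ (pre ω m) = 0 := by
  rw [intAlg, ofTuple_preL] at h
  split_ifs at h with h'
  by_cases h0 : cylP μ (pre ω m) = 0
  · exact Or.inr h0
  · exact Or.inl fun ⟨y, hy⟩ => h' ⟨y, h0, hy⟩

variable [IsProbabilityMeasure μ] [IsProbabilityMeasure ν]

theorem measureReal_intAlg_none_le (n m : ℕ) :
    μ.real {ω | ∀ i ≤ m, intAlg μ ν n (preL ω i) = none} ≤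
      μ.real {ω | ¬ IntStopped μ ν n m ω} := by
  have h : {ω | ∀ i ≤ m, intAlg μ ν n (preL ω i) = none} ⊆
      {ω | ¬ IntStopped μ ν n m ω} ∪ {ω | cylP μ (pre ω m) = 0} :=
    fun ω hω => not_intStopped_of_intAlg_eq_none μ ν (hω m le_rfl)
  have := (measureReal_mono (μ := μ) h).trans (measureReal_union_le _ _)
  rwa [measureReal_cylP_eq_zero, add_zero] at this

theorem measure_out_intAlg_le (y : Fin n → 𝒴) :
    μ.real (out (intAlg μ ν n) y) ≤ cylP ν y := by
  have h : ∀ m, μ (outBy (intAlg μ ν n) y m) ≤ ENNReal.ofReal (cylP ν y) := by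
    intro m
    rw [← ofReal_measureReal]
    refine ENNReal.ofReal_le_ofReal ?_
    refine (measureReal_mono ?_).trans (measureReal_itv_subset_le μ (m := m) ν y)
    rintro ω ⟨i, hi, h1, -⟩
    exact (itv_pre_subset μ ω hi).trans (itv_subset_of_intAlg_eq_some μ ν h1)
  rw [out_eq_iUnion, Measure.real, (outBy_mono _ y).measure_iUnion]
  exact ENNReal.toReal_le_of_le_ofReal (cylP_nonneg ν y) (iSup_le h)

/-- The interval algorithm is valid as soon as it stops almost surely. -/
theorem valid_intAlg
    (h : Tendsto (fun m => μ.real {ω | ¬ IntStopped μ ν n m ω}) atTop (nhds 0)) :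
    Valid μ (fun y : Fin n → 𝒴 => cylP ν y) (intAlg μ ν n) := by
  set φ := intAlg μ ν n
  have hle : ∀ y ∈ Finset.univ, μ.real (out φ y) ≤ cylP ν y :=
    fun y _ => measure_out_intAlg_le μ ν y
  have hsum : ∑ y, μ.real (out φ y) = ∑ y : Fin n → 𝒴, cylP ν y := by
    refine le_antisymm (Finset.sum_le_sum hle) ?_
    rw [sum_cylP, ← measureReal_biUnion_finset (fun y _ y' _ h => disjoint_out φ h)
      (fun y _ => measurableSet_out φ y)]
    refine le_of_tendsto_of_tendsto' tendsto_const_nhds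
      (by simpa using h.const_add (μ.real (⋃ y ∈ Finset.univ, out φ y))) fun m => ?_
    refine le_trans ?_ (add_le_add_right (measureReal_intAlg_none_le μ ν n m) _)
    refine le_trans ?_ (measureReal_union_le _ _)
    rw [← probReal_univ (μ := μ)]
    refine measureReal_mono fun ω _ => ?_
    by_cases hω : ∀ i ≤ m, φ (preL ω i) = none
    · exact Or.inr hω
    · left
      push Not at hω
      obtain ⟨i, hi, hi'⟩ := hω
      obtain ⟨y, hy⟩ := exists_mem_outBy φ hi hi'
      simp only [Set.mem_iUnion]
      refine ⟨y, ?_⟩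
      rw [out_eq_iUnion]
      exact Set.mem_iUnion.2 ⟨m, hy⟩
  exact fun y => (Finset.sum_eq_sum_iff_of_le hle).1 hsum y (Finset.mem_univ y)

end IntervalAlgorithm

section Poisson

variable {𝒴 ι : Type*} [Fintype 𝒴]

/-- `V` is a direct sum of irreducible stochastic matrices on the fibres of `c`, and `π ξ` is a
stationary distribution supported on the fibre over `ξ`. -/
structure IsBlockChain [DecidableEq 𝒴] (V : Matrix 𝒴 𝒴 ℝ) (c : 𝒴 → ι) (π : ι → 𝒴 → ℝ) :
    Prop where
  trans : IsTransMat V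
  block : ∀ y y', c y ≠ c y' → V y y' = 0
  irred : ∀ y y', c y = c y' → ∃ k : ℕ, 1 ≤ k ∧ 0 < (V ^ k) y y'
  stat : ∀ ξ, IsStationary (π ξ) V
  supp : ∀ ξ y, c y ≠ ξ → π ξ y = 0

variable [DecidableEq 𝒴] {V : Matrix 𝒴 𝒴 ℝ} {c : 𝒴 → ι} {π : ι → 𝒴 → ℝ}

theorem IsBlockChain.pow_nonneg (hV : IsBlockChain V c π) (k : ℕ) (y y' : 𝒴) :
    0 ≤ (V ^ k) y y' := by
  induction k generalizing y y' with
  | zero => rw [pow_zero, Matrix.one_apply]; split_ifs <;> norm_num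
  | succ k ih =>
    rw [pow_succ, Matrix.mul_apply]
    exact Finset.sum_nonneg fun z _ => mul_nonneg (ih y z) (hV.trans.1 z y')

theorem IsBlockChain.pow_block (hV : IsBlockChain V c π) (k : ℕ) (y y' : 𝒴) (h : c y ≠ c y') :
    (V ^ k) y y' = 0 := by
  induction k generalizing y y' with
  | zero => rw [pow_zero, Matrix.one_apply_ne fun he => h (congrArg c he)]
  | succ k ih =>
    rw [pow_succ, Matrix.mul_apply]
    refine Finset.sum_eq_zero fun z _ => ?_
    by_cases hz : c y = c z
    · rw [hV.block z y' fun he => h (hz.trans he), mul_zero]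
    · rw [ih y z hz, zero_mul]

theorem IsBlockChain.pow_sum (hV : IsBlockChain V c π) (k : ℕ) (y : 𝒴) :
    ∑ y', (V ^ k) y y' = 1 := by
  induction k generalizing y with
  | zero => simp [Matrix.one_apply]
  | succ k ih =>
    simp_rw [pow_succ, Matrix.mul_apply]
    rw [Finset.sum_comm]
    simp_rw [← Finset.mul_sum, hV.trans.2, mul_one]
    exact ih y

/-- Harmonic functions are constant on the irreducible classes. -/
theorem IsBlockChain.harmonic_const (hV : IsBlockChain V c π) {h : 𝒴 → ℝ}
    (hh : ∀ y, ∑ y', V y y' * h y' = h y) (y y' : 𝒴) (hc : c y = c y') : h y = h y' := by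
  have hpow : ∀ (k : ℕ) (y : 𝒴), ∑ y', (V ^ k) y y' * h y' = h y := by
    intro k
    induction k with
    | zero => intro y; simp [Matrix.one_apply]
    | succ k ih =>
      intro y
      simp_rw [pow_succ, Matrix.mul_apply, Finset.sum_mul]
      rw [Finset.sum_comm]
      simp_rw [mul_assoc, ← Finset.mul_sum, hh]
      exact ih y
  obtain ⟨z, hz, hmax⟩ := Finset.exists_max_image (Finset.univ.filter fun z => c z = c y) h
    ⟨y, by simp⟩
  have hzc : c z = c y := (Finset.mem_filter.1 hz).2
  have key : ∀ w, c w = c y → h w = h z := by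
    intro w hw
    obtain ⟨k, -, hk⟩ := hV.irred z w (hzc.trans hw.symm)
    have h0 : ∑ v, (V ^ k) z v * (h z - h v) = 0 := by
      simp_rw [mul_sub, Finset.sum_sub_distrib, ← Finset.sum_mul, hV.pow_sum, hpow]
      ring
    have hnn : ∀ v ∈ Finset.univ, 0 ≤ (V ^ k) z v * (h z - h v) := by
      intro v _
      by_cases hv : c z = c v
      · exact mul_nonneg (hV.pow_nonneg k z v) (sub_nonneg.2 (hmax v (by simp [← hv, hzc])))
      · rw [hV.pow_block k z v hv, zero_mul]
    have := (Finset.sum_eq_zero_iff_of_nonneg hnn).1 h0 w (Finset.mem_univ w)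
    rcases mul_eq_zero.1 this with h1 | h1
    · exact absurd h1 hk.ne'
    · linarith
  rw [key y rfl, key y' hc.symm]

theorem IsBlockChain.sum_stat_sub (hV : IsBlockChain V c π) (ξ : ι) (h : 𝒴 → ℝ) :
    ∑ y, π ξ y * (h y - ∑ y', V y y' * h y') = 0 := by
  simp_rw [mul_sub, Finset.sum_sub_distrib, Finset.mul_sum]
  rw [Finset.sum_comm (f := fun y y' => π ξ y * (V y y' * h y'))]
  simp_rw [← mul_assoc, ← Finset.sum_mul, (hV.stat ξ).2.2]
  exact sub_self _

theorem IsBlockChain.sum_stat_class (hV : IsBlockChain V c π) (ξ : ι) (g : ι → ℝ) :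
    ∑ y, π ξ y * g (c y) = g ξ := by
  have : ∀ y, π ξ y * g (c y) = π ξ y * g ξ := by
    intro y
    by_cases hy : c y = ξ
    · rw [hy]
    · rw [hV.supp ξ y hy, zero_mul, zero_mul]
  simp_rw [this, ← Finset.sum_mul, (hV.stat ξ).2.1, one_mul]

/-- Solvability of the Poisson equation for functions with mean zero on every class. -/
theorem IsBlockChain.exists_poisson (hV : IsBlockChain V c π) {g : 𝒴 → ℝ}
    (hg : ∀ ξ, ∑ y, π ξ y * g y = 0) :
    ∃ h : 𝒴 → ℝ, ∀ y, h y - ∑ y', V y y' * h y' = g y := by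
  let L : (𝒴 → ℝ) →ₗ[ℝ] (𝒴 → ℝ) :=
    { toFun := fun h y => h y - ∑ y', V y y' * h y' + ∑ z, π (c y) z * h z
      map_add' := by
        intro h h'
        funext y
        simp only [Pi.add_apply, mul_add, Finset.sum_add_distrib]
        ring
      map_smul' := by
        intro a h
        funext y
        simp only [Pi.smul_apply, smul_eq_mul, RingHom.id_apply, mul_add, mul_sub,
          Finset.mul_sum, mul_left_comm] }
  have hL : ∀ h y, L h y = h y - ∑ y', V y y' * h y' + ∑ z, π (c y) z * h z := fun _ _ => rfl
  have hmean : ∀ h ξ, ∑ y, π ξ y * L h y = ∑ z, π ξ z * h z := by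
    intro h ξ
    simp_rw [hL, mul_add, Finset.sum_add_distrib]
    rw [hV.sum_stat_sub, zero_add]
    exact hV.sum_stat_class ξ fun ξ' => ∑ z, π ξ' z * h z
  have hinj : Function.Injective L := by
    rw [injective_iff_map_eq_zero]
    intro h hh
    have hz : ∀ ξ, ∑ z, π ξ z * h z = 0 := fun ξ => by rw [← hmean, hh]; simp
    have hharm : ∀ y, ∑ y', V y y' * h y' = h y := by
      intro y
      have := congrFun hh y
      rw [hL, hz] at this
      simp only [Pi.zero_apply] at this
      linarith
    funext y
    have h1 := hz (c y)
    have h2 : ∀ z, π (c y) z * h z = π (c y) z * h y := by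
      intro z
      by_cases hc : c z = c y
      · rw [hV.harmonic_const hharm z y hc]
      · rw [hV.supp _ z hc, zero_mul, zero_mul]
    simp_rw [h2, ← Finset.sum_mul, (hV.stat (c y)).2.1, one_mul] at h1
    exact h1
  obtain ⟨h, hh⟩ := LinearMap.injective_iff_surjective.1 hinj g
  refine ⟨h, fun y => ?_⟩
  have := hL h y
  rw [hh, ← hmean, hh, hg] at this
  linarith

end Poisson

section Variance

variable {𝒴 : Type*} [Fintype 𝒴]

theorem sum_fin_succ_pi (m : ℕ) (g : (Fin (m + 1) → 𝒴) → ℝ) :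
    ∑ x, g x = ∑ x : Fin m → 𝒴, ∑ a, g (Fin.snoc (α := fun _ => 𝒴) x a) := by
  rw [← (Fin.snocEquiv fun _ : Fin (m + 1) => 𝒴).sum_comp, Fintype.sum_prod_type_right]
  rfl

theorem markovP_snoc (q : 𝒴 → ℝ) (V : 𝒴 → 𝒴 → ℝ) (m : ℕ) (x : Fin (m + 1) → 𝒴) (a : 𝒴) :
    markovP q V (m + 2) (Fin.snoc (α := fun _ => 𝒴) x a)
      = markovP q V (m + 1) x * V (x (Fin.last m)) a := by
  rw [markovP, markovP, Fin.prod_univ_castSucc]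
  simp only [Fin.succ_castSucc, Fin.snoc_castSucc, Fin.succ_last, Fin.snoc_last]
  have : (0 : Fin (m + 2)) = Fin.castSucc 0 := rfl
  rw [this, Fin.snoc_castSucc]
  ring

/-- Sum of `d` over the transitions of a path. -/
def pathSum (d : 𝒴 → 𝒴 → ℝ) (m : ℕ) (x : Fin (m + 1) → 𝒴) : ℝ :=
  ∑ i : Fin m, d (x i.castSucc) (x i.succ)

theorem pathSum_snoc (d : 𝒴 → 𝒴 → ℝ) (m : ℕ) (x : Fin (m + 1) → 𝒴) (a : 𝒴) :
    pathSum d (m + 1) (Fin.snoc (α := fun _ => 𝒴) x a)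
      = pathSum d m x + d (x (Fin.last m)) a := by
  rw [pathSum, pathSum, Fin.sum_univ_castSucc]
  simp only [Fin.succ_castSucc, Fin.snoc_castSucc, Fin.succ_last, Fin.snoc_last]

theorem markovP_nonneg {q : 𝒴 → ℝ} {V : 𝒴 → 𝒴 → ℝ} (hq : IsInitial q) (hV : IsTransMat V)
    (m : ℕ) (x : Fin m → 𝒴) : 0 ≤ markovP q V m x := by
  cases m with
  | zero => exact zero_le_one
  | succ m => exact mul_nonneg (hq.1 _) (Finset.prod_nonneg fun i _ => hV.1 _ _)

theorem sum_markovP {q : 𝒴 → ℝ} {V : 𝒴 → 𝒴 → ℝ} (hq : IsInitial q) (hV : IsTransMat V)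
    (m : ℕ) : ∑ x, markovP q V (m + 1) x = 1 := by
  induction m with
  | zero =>
    rw [sum_fin_succ_pi]
    simpa [markovP, Fin.snoc] using hq.2
  | succ m ih =>
    rw [sum_fin_succ_pi]
    simp_rw [markovP_snoc, ← Finset.mul_sum, hV.2, mul_one]
    exact ih

/-- Second moment bound for sums of bounded martingale differences along a Markov chain. -/
theorem sum_markovP_mul_pathSum_sq_le {q : 𝒴 → ℝ} {V : 𝒴 → 𝒴 → ℝ} (hq : IsInitial q)
    (hV : IsTransMat V) {d : 𝒴 → 𝒴 → ℝ} {D : ℝ} (hd : ∀ y, ∑ y', V y y' * d y y' = 0)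
    (hD : ∀ y y', d y y' ^ 2 ≤ D) (m : ℕ) :
    ∑ x, markovP q V (m + 1) x * pathSum d m x ^ 2 ≤ m * D := by
  induction m with
  | zero => simp [pathSum]
  | succ m ih =>
    rw [sum_fin_succ_pi]
    have hstep : ∀ x : Fin (m + 1) → 𝒴,
        ∑ a, markovP q V (m + 1 + 1) (Fin.snoc (α := fun _ => 𝒴) x a) *
          pathSum d (m + 1) (Fin.snoc (α := fun _ => 𝒴) x a) ^ 2
        ≤ markovP q V (m + 1) x * pathSum d m x ^ 2 + markovP q V (m + 1) x * D := by
      intro x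
      set y := x (Fin.last m)
      have hexp : ∀ a, markovP q V (m + 1 + 1) (Fin.snoc (α := fun _ => 𝒴) x a) *
          pathSum d (m + 1) (Fin.snoc (α := fun _ => 𝒴) x a) ^ 2 =
          markovP q V (m + 1) x * (pathSum d m x ^ 2 * V y a
            + 2 * pathSum d m x * (V y a * d y a) + V y a * d y a ^ 2) := by
        intro a
        rw [markovP_snoc, pathSum_snoc]
        ring
      have hsq : ∑ a, V y a * d y a ^ 2 ≤ D := by
        calc ∑ a, V y a * d y a ^ 2 ≤ ∑ a, V y a * D :=
              Finset.sum_le_sum fun a _ => mul_le_mul_of_nonneg_left (hD y a) (hV.1 y a)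
          _ = D := by rw [← Finset.sum_mul, hV.2, one_mul]
      simp_rw [hexp, ← Finset.mul_sum, Finset.sum_add_distrib, ← Finset.mul_sum]
      rw [hV.2, hd, ← mul_add]
      refine mul_le_mul_of_nonneg_left ?_ (markovP_nonneg hq hV _ x)
      linarith
    refine (Finset.sum_le_sum fun x _ => hstep x).trans ?_
    rw [Finset.sum_add_distrib, ← Finset.sum_mul, sum_markovP hq hV]
    push_cast
    linarith

end Variance

section Equipartition

variable {𝒴 ι : Type*} [Fintype 𝒴]

theorem markovP_pre (q : 𝒴 → ℝ) (V : 𝒴 → 𝒴 → ℝ) (m : ℕ) (ω : ℕ → 𝒴) :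
    markovP q V (m + 1) (pre ω (m + 1))
      = q (ω 0) * ∏ i ∈ Finset.range m, V (ω i) (ω (i + 1)) := by
  rw [← Fin.prod_univ_eq_prod_range fun i => V (ω i) (ω (i + 1))]
  rfl

theorem pathSum_pre (d : 𝒴 → 𝒴 → ℝ) (m : ℕ) (ω : ℕ → 𝒴) :
    pathSum d m (pre ω (m + 1)) = ∑ i ∈ Finset.range m, d (ω i) (ω (i + 1)) := by
  rw [← Fin.sum_univ_eq_sum_range fun i => d (ω i) (ω (i + 1))]
  rfl

theorem abs_le_sum_abs (g : 𝒴 → ℝ) (y : 𝒴) : |g y| ≤ ∑ z, |g z| :=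
  Finset.single_le_sum (f := fun z => |g z|) (fun _ _ => abs_nonneg _) (Finset.mem_univ y)

variable [DecidableEq 𝒴] {V : Matrix 𝒴 𝒴 ℝ} {c : 𝒴 → ι} {π : ι → 𝒴 → ℝ}

/-- Up to a bounded error, the log-likelihood of a path is the entropy of its class plus a sum of
martingale differences. -/
theorem IsBlockChain.exists_martingale_approx (hV : IsBlockChain V c π) (q : 𝒴 → ℝ) :
    ∃ (d : 𝒴 → 𝒴 → ℝ) (K : ℝ), (∀ y, ∑ y', V y y' * d y y' = 0) ∧
      ∀ (m : ℕ) (ω : ℕ → 𝒴), markovP q V (m + 1) (pre ω (m + 1)) ≠ 0 →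
        |Real.logb 2 (markovP q V (m + 1) (pre ω (m + 1)))
          + (m + 1) * matEnt (π (c (ω 0))) V + pathSum d m (pre ω (m + 1))| ≤ K := by
  set F : 𝒴 → ℝ := fun y => ∑ y', V y y' * Real.logb 2 (1 / V y y') with hF
  set H : 𝒴 → ℝ := fun y => matEnt (π (c y)) V with hH
  have hent : ∀ ξ, matEnt (π ξ) V = ∑ y, π ξ y * F y := by
    intro ξ
    simp only [matEnt, hF, Finset.mul_sum, mul_assoc]
  obtain ⟨h, hh⟩ := hV.exists_poisson (g := fun y => F y - H y) (by
    intro ξ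
    simp_rw [mul_sub, Finset.sum_sub_distrib]
    rw [← hent, hV.sum_stat_class ξ fun ξ => matEnt (π ξ) V, sub_self])
  refine ⟨fun y y' => Real.logb 2 (1 / V y y') - H y - h y + h y',
    ∑ z, |Real.logb 2 (q z)| + ∑ z, |h z| + ∑ z, |h z| + ∑ z, |H z|, ?_, ?_⟩
  · intro y
    have hy := hh y
    simp_rw [mul_add, mul_sub, Finset.sum_add_distrib, Finset.sum_sub_distrib,
      ← Finset.sum_mul, hV.trans.2]
    simp only [hF] at hy
    linarith
  · intro m ω hP
    have hexp : markovP q V (m + 1) (pre ω (m + 1))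
        = q (ω 0) * ∏ i ∈ Finset.range m, V (ω i) (ω (i + 1)) := markovP_pre q V m ω
    rw [hexp] at hP ⊢
    have hq0 : q (ω 0) ≠ 0 := left_ne_zero_of_mul hP
    have hprod := right_ne_zero_of_mul hP
    have hne : ∀ i ∈ Finset.range m, V (ω i) (ω (i + 1)) ≠ 0 := Finset.prod_ne_zero_iff.1 hprod
    have hcls : ∀ i ≤ m, c (ω i) = c (ω 0) := by
      intro i
      induction i with
      | zero => intro _; rfl
      | succ i ih =>
        intro hi
        rw [← ih (by omega)]
        by_contra hcon
        exact hne i (Finset.mem_range.2 hi) (hV.block _ _ fun he => hcon he.symm)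
    rw [Real.logb_mul hq0 hprod, Real.logb_prod _ _ hne, pathSum_pre]
    have hterm : ∀ i ∈ Finset.range m,
        Real.logb 2 (1 / V (ω i) (ω (i + 1))) - H (ω i) - h (ω i) + h (ω (i + 1))
        = - Real.logb 2 (V (ω i) (ω (i + 1))) - H (ω 0) - (h (ω i) - h (ω (i + 1))) := by
      intro i hi
      have hHi : H (ω i) = H (ω 0) := by
        simp only [hH]
        rw [hcls i (Finset.mem_range.1 hi).le]
      rw [hHi, one_div, Real.logb_inv]
      ring
    rw [Finset.sum_congr rfl hterm, Finset.sum_sub_distrib, Finset.sum_sub_distrib,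
      Finset.sum_range_sub', Finset.sum_neg_distrib, Finset.sum_const, Finset.card_range,
      nsmul_eq_mul]
    have h1 := abs_le.1 (abs_le_sum_abs (fun z => Real.logb 2 (q z)) (ω 0))
    have h2 := abs_le.1 (abs_le_sum_abs h (ω 0))
    have h3 := abs_le.1 (abs_le_sum_abs h (ω m))
    have h4 := abs_le.1 (abs_le_sum_abs H (ω 0))
    change |_ + (m + 1) * H (ω 0) + _| ≤ _
    rw [abs_le]
    constructor <;> linarith [h1.1, h1.2, h2.1, h2.2, h3.1, h3.2, h4.1, h4.2]

variable [MeasurableSpace 𝒴] [DiscreteMeasurableSpace 𝒴]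

/-- Chebyshev's inequality for sums of martingale differences along a Markov chain. -/
theorem measureReal_le_abs_pathSum (hV : IsTransMat V) {q : 𝒴 → ℝ} (hq : IsInitial q)
    {ν : Measure (ℕ → 𝒴)} [IsProbabilityMeasure ν] (hν : IsMarkovMeasure ν q V)
    {d : 𝒴 → 𝒴 → ℝ} {D : ℝ} (hd : ∀ y, ∑ y', V y y' * d y y' = 0)
    (hD : ∀ y y', d y y' ^ 2 ≤ D) (m : ℕ) {t : ℝ} (ht : 0 < t) :
    ν.real {ω | t ≤ |pathSum d m (pre ω (m + 1))|} ≤ m * D / t ^ 2 := by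
  rw [measureReal_pre ν (A := fun x => t ≤ |pathSum d m x|)
    (s := {x | t ≤ |pathSum d m x|}) (by simp), le_div_iff₀ (by positivity), Finset.sum_mul]
  simp_rw [hν (m + 1)]
  refine le_trans ?_ (sum_markovP_mul_pathSum_sq_le hq hV hd hD m)
  refine le_trans (Finset.sum_le_sum fun x hx => ?_) (Finset.sum_le_sum_of_subset_of_nonneg
    (Finset.subset_univ _) fun x _ _ => mul_nonneg (markovP_nonneg hq hV _ x) (sq_nonneg _))
  refine mul_le_mul_of_nonneg_left ?_ (markovP_nonneg hq hV _ x)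
  rw [← sq_abs (pathSum d m x)]
  exact pow_le_pow_left₀ ht.le (Finset.mem_filter.1 hx).2 2

/-- Asymptotic equipartition for a direct sum of irreducible Markov chains: the normalised
log-likelihood converges in probability to the entropy rate of the initial class. -/
theorem IsBlockChain.tendsto_measureReal_atypical (hV : IsBlockChain V c π) {q : 𝒴 → ℝ}
    (hq : IsInitial q) {ν : Measure (ℕ → 𝒴)} [IsProbabilityMeasure ν]
    (hν : IsMarkovMeasure ν q V) {δ : ℝ} (hδ : 0 < δ) :
    Tendsto (fun n : ℕ => ν.real {ω | ¬
      ((2 : ℝ) ^ (-((n : ℝ) * (matEnt (π (c (ω 0))) V + δ))) ≤ cylP ν (pre ω n) ∧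
        cylP ν (pre ω n) ≤ (2 : ℝ) ^ (-((n : ℝ) * (matEnt (π (c (ω 0))) V - δ))))})
      atTop (nhds 0) := by
  obtain ⟨d, K, hd, hK⟩ := hV.exists_martingale_approx q
  obtain ⟨D, hD⟩ : ∃ D : ℝ, ∀ y y', d y y' ^ 2 ≤ D := by
    refine ⟨∑ y, abs (∑ y', |d y y' ^ 2|), fun y y' => ?_⟩
    have h1 := abs_le_sum_abs (fun y' => d y y' ^ 2) y'
    have h2 := abs_le_sum_abs (fun y => ∑ y', |d y y' ^ 2|) y
    exact (le_abs_self _).trans (h1.trans ((le_abs_self _).trans h2))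
  rw [← tendsto_add_atTop_iff_nat 1]
  have hlim : Tendsto (fun m : ℕ => 4 * |D| / δ ^ 2 * (1 / ((m : ℝ) + 1))) atTop (nhds 0) := by
    have h := tendsto_one_div_add_atTop_nhds_zero_nat.const_mul (4 * |D| / δ ^ 2)
    rwa [mul_zero] at h
  refine tendsto_of_tendsto_of_tendsto_of_le_of_le' tendsto_const_nhds hlim
    (Eventually.of_forall fun _ => measureReal_nonneg) ?_
  obtain ⟨N, hN⟩ := exists_nat_gt (2 * K / δ)
  filter_upwards [eventually_ge_atTop N] with m hm
  have hm1 : (0 : ℝ) < (m : ℝ) + 1 := by positivity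
  have hKm : 2 * K ≤ δ * ((m : ℝ) + 1) := by
    have hmN : (N : ℝ) ≤ m := by exact_mod_cast hm
    rw [div_lt_iff₀ hδ] at hN
    nlinarith
  set t : ℝ := δ * ((m : ℝ) + 1) / 2 with ht
  have ht0 : 0 < t := by positivity
  have hbound : ν.real {ω | t ≤ |pathSum d m (pre ω (m + 1))|}
      ≤ 4 * |D| / δ ^ 2 * (1 / ((m : ℝ) + 1)) := by
    refine (measureReal_le_abs_pathSum hV.trans hq hν hd hD m ht0).trans ?_
    have : 4 * |D| / δ ^ 2 * (1 / ((m : ℝ) + 1)) = ((m : ℝ) + 1) * |D| / t ^ 2 := by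
      rw [ht]; field_simp; try ring
    rw [this]
    have hmD : (m : ℝ) * D ≤ ((m : ℝ) + 1) * |D| := by
      nlinarith [le_abs_self D, abs_nonneg D, (Nat.cast_nonneg m : (0 : ℝ) ≤ m)]
    gcongr
  refine le_trans ?_ hbound
  have hz := measureReal_cylP_eq_zero ν (m + 1)
  rw [← zero_add (ν.real {ω | t ≤ |pathSum d m (pre ω (m + 1))|}), ← hz]
  refine (measureReal_mono ?_).trans (measureReal_union_le _ _)
  intro ω hω
  by_cases hP : cylP ν (pre ω (m + 1)) = 0
  · exact Or.inl hP
  right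
  by_contra hS
  refine hω ?_
  have hS' : |pathSum d m (pre ω (m + 1))| < t := not_le.1 hS
  have hPpos : 0 < cylP ν (pre ω (m + 1)) := lt_of_le_of_ne (cylP_nonneg ν _) (Ne.symm hP)
  have hKω := hK m ω (by rw [← hν]; exact hP)
  rw [← hν] at hKω
  have h1 := abs_le.1 hKω
  have h2 := abs_lt.1 hS'
  rw [← Real.le_logb_iff_rpow_le one_lt_two hPpos, ← Real.logb_le_iff_le_rpow one_lt_two hPpos]
  push_cast
  constructor <;> linarith [h1.1, h1.2, h2.1, h2.2]

end Equipartition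

section Rates

variable {𝒳 𝒴 : Type*} [Fintype 𝒳] [MeasurableSpace 𝒳] [DiscreteMeasurableSpace 𝒳]
  [Fintype 𝒴] [MeasurableSpace 𝒴] [DiscreteMeasurableSpace 𝒴]

/-- The likelihoods of the process `μ` satisfy the equipartition property with rate `H`. -/
def HasEquipartition (μ : Measure (ℕ → 𝒳)) (H : ℝ) : Prop :=
  ∀ δ : ℝ, 0 < δ → Tendsto (fun m : ℕ => μ.real {ω | ¬
    ((2 : ℝ) ^ (-((m : ℝ) * (H + δ))) ≤ cylP μ (pre ω m) ∧
      cylP μ (pre ω m) ≤ (2 : ℝ) ^ (-((m : ℝ) * (H - δ))))}) atTop (nhds 0)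

variable {μ : Measure (ℕ → 𝒳)} [IsProbabilityMeasure μ]
  {ν : Measure (ℕ → 𝒴)} [IsProbabilityMeasure ν] {H M R : ℝ}

theorem HasEquipartition.tendsto_upper (h : HasEquipartition μ H) {δ : ℝ} (hδ : 0 < δ) :
    Tendsto (fun m : ℕ => μ.real {ω | (2 : ℝ) ^ (-((m : ℝ) * (H - δ))) < cylP μ (pre ω m)})
      atTop (nhds 0) := by
  refine squeeze_zero (fun _ => measureReal_nonneg) (fun m => ?_) (h δ hδ)
  refine measureReal_mono fun ω hω hc => ?_
  exact not_le.2 hω hc.2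

theorem HasEquipartition.tendsto_lower (h : HasEquipartition μ H) {δ : ℝ} (hδ : 0 < δ) :
    Tendsto (fun m : ℕ => μ.real {ω | cylP μ (pre ω m) < (2 : ℝ) ^ (-((m : ℝ) * (H + δ)))})
      atTop (nhds 0) := by
  refine squeeze_zero (fun _ => measureReal_nonneg) (fun m => ?_) (h δ hδ)
  refine measureReal_mono fun ω hω hc => ?_
  exact not_le.2 hω hc.1

theorem tendsto_two_rpow_neg_mul {κ : ℝ} (hκ : 0 < κ) (C : ℝ) :
    Tendsto (fun m : ℕ => (2 : ℝ) ^ (-((m : ℝ) * κ) + C)) atTop (nhds 0) :=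
  (tendsto_rpow_atBot_of_base_gt_one 2 one_lt_two).comp
    (tendsto_atBot_add_const_right _ _
      (tendsto_neg_atTop_atBot.comp (tendsto_natCast_atTop_atTop.atTop_mul_const hκ)))

theorem tendsto_floor_mul (hR : 0 < R) :
    Tendsto (fun n : ℕ => ⌊(n : ℝ) * R⌋₊) atTop atTop :=
  tendsto_nat_floor_atTop.comp (tendsto_natCast_atTop_atTop.atTop_mul_const hR)

theorem Achievable.mono {R' : ℝ} (h : Achievable μ ν R) (hR : R ≤ R') : Achievable μ ν R' := by
  obtain ⟨h0, φ, hφ, hlim⟩ := h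
  refine ⟨h0.trans hR, φ, hφ, squeeze_zero (fun _ => ENNReal.toReal_nonneg) (fun n => ?_) hlim⟩
  refine measureReal_mono (μ := μ) fun ω hω i hi => hω i (hi.trans ?_)
  exact Nat.floor_le_floor (mul_le_mul_of_nonneg_left hR (Nat.cast_nonneg n))

/-- Converse bound on achievable rates: if the target likelihood is at most `2 ^ (-n (M - δ))`
with probability bounded below, then no rate below `M / H` is achievable. -/
theorem le_of_achievable (hX : HasEquipartition μ H) (hH : 0 < H)
    (hY : ∀ δ : ℝ, 0 < δ → ∃ w : ℝ, 0 < w ∧ ∀ᶠ n : ℕ in atTop,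
      w ≤ ν.real {ω | cylP ν (pre ω n) ≤ (2 : ℝ) ^ (-((n : ℝ) * (M - δ)))})
    (hR : Achievable μ ν R) : M / H ≤ R := by
  by_contra! hlt
  obtain ⟨R', hR1, hR2⟩ := exists_between hlt
  obtain ⟨-, φ, hφ, hlim⟩ := hR.mono hR1.le
  have hR' : 0 < R' := hR.1.trans_lt hR1
  rw [lt_div_iff₀ hH] at hR2
  set δ : ℝ := (M - R' * H) / (2 * (1 + R')) with hδdef
  have hδ : 0 < δ := div_pos (by linarith) (by linarith)
  have hδ' : δ * (2 * (1 + R')) = M - R' * H := by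
    rw [hδdef]; field_simp
  obtain ⟨w, hw, hev⟩ := hY δ hδ
  have hsum := hlim.add ((hX.tendsto_lower hδ).comp (tendsto_floor_mul hR'))
  rw [add_zero] at hsum
  obtain ⟨n, ⟨hn1, hn2⟩, hn3⟩ :=
    ((hev.and (hsum.eventually_lt_const hw)).and (eventually_ge_atTop 1)).exists
  have hn : (1 : ℝ) ≤ n := by exact_mod_cast hn3
  have hfl : ((⌊(n : ℝ) * R'⌋₊ : ℕ) : ℝ) ≤ n * R' := Nat.floor_le (by positivity)
  have hexp : (2 : ℝ) ^ (-((n : ℝ) * (M - δ)))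
      < (2 : ℝ) ^ (-(((⌊(n : ℝ) * R'⌋₊ : ℕ) : ℝ) * (H + δ))) := by
    refine Real.rpow_lt_rpow_of_exponent_lt one_lt_two (neg_lt_neg ?_)
    calc ((⌊(n : ℝ) * R'⌋₊ : ℕ) : ℝ) * (H + δ) ≤ n * R' * (H + δ) :=
          mul_le_mul_of_nonneg_right hfl (by linarith)
      _ = n * (R' * (H + δ)) := by ring
      _ < n * (M - δ) := by
        refine mul_lt_mul_of_pos_left ?_ (by linarith)
        nlinarith
  have := measureReal_cylP_le_of_valid μ ν (hφ n) ⌊(n : ℝ) * R'⌋₊ hexp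
  exact absurd (hn1.trans this) (not_le.2 hn2)

end Rates

section IntervalRates

variable {𝒳 𝒴 : Type*} [Fintype 𝒳] [LinearOrder 𝒳] [MeasurableSpace 𝒳]
  [DiscreteMeasurableSpace 𝒳] [Fintype 𝒴] [LinearOrder 𝒴] [MeasurableSpace 𝒴]
  [DiscreteMeasurableSpace 𝒴] {μ : Measure (ℕ → 𝒳)} [IsProbabilityMeasure μ]
  {ν : Measure (ℕ → 𝒴)} [IsProbabilityMeasure ν] {H M R : ℝ}

theorem HasEquipartition.tendsto_not_intStopped (hX : HasEquipartition μ H) (hH : 0 < H)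
    (n : ℕ) : Tendsto (fun m => μ.real {ω | ¬ IntStopped μ ν n m ω}) atTop (nhds 0) := by
  obtain ⟨b, hb, hb0⟩ : ∃ b : ℝ, (∀ y : Fin n → 𝒴, cylP ν y ≠ 0 → b ≤ cylP ν y) ∧ 0 < b := by
    have h : ∀ᶠ b : ℝ in nhdsWithin 0 (Set.Ioi 0),
        ∀ y : Fin n → 𝒴, cylP ν y ≠ 0 → b ≤ cylP ν y := by
      refine eventually_all.2 fun y => ?_
      by_cases hy : cylP ν y = 0
      · exact Eventually.of_forall fun b h => absurd hy h
      · have hpos : 0 < cylP ν y := lt_of_le_of_ne (cylP_nonneg ν y) (Ne.symm hy)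
        filter_upwards [nhdsWithin_le_nhds (eventually_lt_nhds hpos)] with b hb _
        exact hb.le
    exact (h.and self_mem_nhdsWithin).exists
  have hnull : ν.real {ω | cylP ν (pre ω n) < b} ≤ 0 := by
    rw [← measureReal_cylP_eq_zero ν n]
    refine measureReal_mono fun ω hω => ?_
    by_contra hne
    exact absurd (hb _ hne) (not_le.2 hω)
  have hH2 : 0 < H / 2 := half_pos hH
  have hlim := (hX.tendsto_upper hH2).add
    (((tendsto_two_rpow_neg_mul hH2 0).const_mul 2).div_const b)
  rw [mul_zero, zero_div, add_zero] at hlim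
  refine squeeze_zero (fun _ => measureReal_nonneg) (fun m => ?_) hlim
  have h := measureReal_not_intStopped_le μ ν n m
    (a := (2 : ℝ) ^ (-((m : ℝ) * (H - H / 2)))) (by positivity) hb0
  rw [sub_half] at h ⊢
  rw [add_zero]
  linarith

theorem IntAchievable.achievable (hX : HasEquipartition μ H) (hH : 0 < H)
    (hR : IntAchievable μ ν R) : Achievable μ ν R :=
  ⟨hR.1, fun n => intAlg μ ν n, fun n => valid_intAlg μ ν (hX.tendsto_not_intStopped hH n),
    squeeze_zero (fun _ => ENNReal.toReal_nonneg)
      (fun n => measureReal_intAlg_none_le μ ν n ⌊(n : ℝ) * R⌋₊) hR.2⟩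

/-- Direct part: the interval algorithm achieves every rate above `M / H`. -/
theorem intAchievable_of_lt (hX : HasEquipartition μ H) (hH : 0 < H) (hM : 0 ≤ M)
    (hY : ∀ δ : ℝ, 0 < δ → Tendsto (fun n : ℕ =>
      ν.real {ω | cylP ν (pre ω n) < (2 : ℝ) ^ (-((n : ℝ) * (M + δ)))}) atTop (nhds 0))
    (hR : M / H < R) : IntAchievable μ ν R := by
  have hR0 : 0 < R := (div_nonneg hM hH.le).trans_lt hR
  rw [div_lt_iff₀ hH] at hR
  set δ : ℝ := min (H / 2) ((R * H - M) / (2 * (1 + R))) with hδdef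
  have hδ : 0 < δ := lt_min (half_pos hH) (div_pos (by linarith) (by linarith))
  have hδ1 : δ ≤ H / 2 := min_le_left _ _
  have hδ2 : δ * (2 * (1 + R)) ≤ R * H - M := by
    rw [← le_div_iff₀ (by positivity)]
    exact min_le_right _ _
  set κ : ℝ := R * (H - δ) - (M + δ) with hκdef
  have hκ : 0 < κ := by rw [hκdef]; nlinarith
  have hlim := (((hX.tendsto_upper hδ).comp (tendsto_floor_mul hR0)).add (hY δ hδ)).add
    ((tendsto_two_rpow_neg_mul hκ (H - δ)).const_mul 2)
  rw [mul_zero, add_zero, add_zero] at hlim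
  refine ⟨hR0.le, squeeze_zero (fun _ => ENNReal.toReal_nonneg) (fun n => ?_) hlim⟩
  set m := ⌊(n : ℝ) * R⌋₊ with hm
  have h := measureReal_not_intStopped_le μ ν n m
    (a := (2 : ℝ) ^ (-((m : ℝ) * (H - δ)))) (b := (2 : ℝ) ^ (-((n : ℝ) * (M + δ))))
    (by positivity) (by positivity)
  refine h.trans (add_le_add le_rfl ?_)
  rw [mul_div_assoc, ← Real.rpow_sub two_pos]
  refine mul_le_mul_of_nonneg_left ?_ zero_le_two
  refine Real.rpow_le_rpow_of_exponent_le one_le_two ?_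
  have hfl : (n : ℝ) * R < m + 1 := Nat.lt_floor_add_one _
  have hHδ : 0 < H - δ := by linarith
  rw [hκdef]
  nlinarith [mul_lt_mul_of_pos_right hfl hHδ]

end IntervalRates

section Markov

variable {𝒴 ι : Type*} [Fintype 𝒴]

theorem matEnt_nonneg {π : 𝒴 → ℝ} {V : 𝒴 → 𝒴 → ℝ} (hV : IsTransMat V) (hπ : IsStationary π V) :
    0 ≤ matEnt π V := by
  refine Finset.sum_nonneg fun y _ => Finset.sum_nonneg fun y' _ =>
    mul_nonneg (mul_nonneg (hπ.1 y) (hV.1 y y')) ?_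
  have hle : V y y' ≤ 1 := by
    rw [← hV.2 y]
    exact Finset.single_le_sum (fun z _ => hV.1 y z) (Finset.mem_univ y')
  rw [one_div, Real.logb_inv, neg_nonneg]
  exact Real.logb_nonpos one_lt_two (hV.1 y y') hle

variable [DecidableEq 𝒴] [MeasurableSpace 𝒴] [DiscreteMeasurableSpace 𝒴]
  {V : Matrix 𝒴 𝒴 ℝ} {c : 𝒴 → ι} {π : ι → 𝒴 → ℝ} {q : 𝒴 → ℝ}
  {ν : Measure (ℕ → 𝒴)} [IsProbabilityMeasure ν] {M : ℝ}

theorem IsBlockChain.tendsto_cylP_lt (hV : IsBlockChain V c π) (hq : IsInitial q)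
    (hν : IsMarkovMeasure ν q V) (hM : ∀ y, 0 < q y → matEnt (π (c y)) V ≤ M) {δ : ℝ}
    (hδ : 0 < δ) :
    Tendsto (fun n : ℕ => ν.real {ω | cylP ν (pre ω n) < (2 : ℝ) ^ (-((n : ℝ) * (M + δ)))})
      atTop (nhds 0) := by
  refine tendsto_of_tendsto_of_tendsto_of_le_of_le' tendsto_const_nhds
    (hV.tendsto_measureReal_atypical hq hν hδ)
    (Eventually.of_forall fun _ => measureReal_nonneg) ?_
  filter_upwards [eventually_ge_atTop 1] with n hn
  refine measureReal_mono fun ω hω hc => ?_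
  have hpos : 0 < cylP ν (pre ω n) := lt_of_lt_of_le (by positivity) hc.1
  have hq0 : 0 < q (ω 0) := by
    obtain ⟨k, rfl⟩ : ∃ k, n = k + 1 := ⟨n - 1, by omega⟩
    rw [hν] at hpos
    exact lt_of_le_of_ne (hq.1 _) (Ne.symm (left_ne_zero_of_mul hpos.ne'))
  refine not_le.2 hω (le_trans ?_ hc.1)
  refine Real.rpow_le_rpow_of_exponent_le one_le_two (neg_le_neg ?_)
  exact mul_le_mul_of_nonneg_left (by linarith [hM _ hq0]) (Nat.cast_nonneg n)

theorem IsBlockChain.eventually_le_cylP_le (hV : IsBlockChain V c π) (hq : IsInitial q)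
    (hν : IsMarkovMeasure ν q V) {y : 𝒴} (hy : 0 < q y) {δ : ℝ} (hδ : 0 < δ) :
    ∃ w : ℝ, 0 < w ∧ ∀ᶠ n : ℕ in atTop, w ≤ ν.real {ω | cylP ν (pre ω n)
      ≤ (2 : ℝ) ^ (-((n : ℝ) * (matEnt (π (c y)) V - δ)))} := by
  have hy1 : ν.real {ω | ω 0 = y} = q y := by
    have h := hν 1 fun _ => y
    simp only [cylP, markovP, Finset.univ_eq_empty, Finset.prod_empty, mul_one] at h
    rw [← h, Measure.real]
    congr 2
    ext ω
    simp
  refine ⟨q y / 2, half_pos hy, ?_⟩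
  filter_upwards [(hV.tendsto_measureReal_atypical hq hν hδ).eventually_lt_const (half_pos hy)]
    with n hn
  have hsub : {ω : ℕ → 𝒴 | ω 0 = y} ⊆
      {ω | cylP ν (pre ω n) ≤ (2 : ℝ) ^ (-((n : ℝ) * (matEnt (π (c y)) V - δ)))} ∪
      {ω | ¬ ((2 : ℝ) ^ (-((n : ℝ) * (matEnt (π (c (ω 0))) V + δ))) ≤ cylP ν (pre ω n) ∧
        cylP ν (pre ω n) ≤ (2 : ℝ) ^ (-((n : ℝ) * (matEnt (π (c (ω 0))) V - δ))))} := by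
    intro ω hω
    by_cases h : cylP ν (pre ω n) ≤ (2 : ℝ) ^ (-((n : ℝ) * (matEnt (π (c y)) V - δ)))
    · exact Or.inl h
    · refine Or.inr fun hc => h ?_
      have hω' : ω 0 = y := hω
      rw [← hω']
      exact hc.2
  have := (measureReal_mono (μ := ν) hsub).trans (measureReal_union_le _ _)
  rw [hy1] at this
  linarith

end Markov

theorem csInf_eq_of_Ioi_subset {S : Set ℝ} {r : ℝ} (h1 : Set.Ioi r ⊆ S) (h2 : ∀ x ∈ S, r ≤ x) :
    sInf S = r :=
  le_antisymm (le_of_forall_gt_imp_ge_of_dense fun _ hx => csInf_le ⟨r, h2⟩ (h1 hx))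
    (le_csInf (Set.nonempty_Ioi.mono h1) h2)

end RNG

/-- **Markov coin / reducible Markov target, overflow criterion.** For an irreducible
Markov coin `μ` (transition matrix `W`, `H^W(X) > 0`) and a target `ν` that is a Markov
chain whose transition matrix `V` is a direct sum of irreducible matrices on the classes
`c⁻¹(ξ)` with weights `w(ξ)`, the infimum achievable rates satisfy
`R⋆_int(X,Y) = R⋆(X,Y) = (1/H^W(X)) · max{H^{V_ξ} : w(ξ) > 0}`. -/
theorem markov_Rstar
    {𝒳 𝒴 : Type*} [Fintype 𝒳] [LinearOrder 𝒳] [MeasurableSpace 𝒳] [DiscreteMeasurableSpace 𝒳]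
    [Fintype 𝒴] [LinearOrder 𝒴] [MeasurableSpace 𝒴] [DiscreteMeasurableSpace 𝒴]
    (W : Matrix 𝒳 𝒳 ℝ) (hW : IsTransMat W) (hWirr : IrreducibleMat W)
    (πX : 𝒳 → ℝ) (hπX : IsStationary πX W) (hpos : 0 < matEnt πX W)
    (p : 𝒳 → ℝ) (hp : IsInitial p)
    (μ : Measure (ℕ → 𝒳)) [IsProbabilityMeasure μ] (hμ : IsMarkovMeasure μ p W)
    (r : ℕ) (c : 𝒴 → Fin r) (V : Matrix 𝒴 𝒴 ℝ) (hV : IsTransMat V)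
    (hblock : ∀ y y' : 𝒴, c y ≠ c y' → V y y' = 0)
    (hVirr : ∀ (ξ : Fin r) (y y' : 𝒴), c y = ξ → c y' = ξ →
      ∃ k : ℕ, 1 ≤ k ∧ 0 < (V ^ k) y y')
    (πY : Fin r → 𝒴 → ℝ) (hπY : ∀ ξ, IsStationary (πY ξ) V)
    (hsupp : ∀ (ξ : Fin r) (y : 𝒴), c y ≠ ξ → πY ξ y = 0)
    (q : 𝒴 → ℝ) (hq : IsInitial q)
    (ν : Measure (ℕ → 𝒴)) [IsProbabilityMeasure ν] (hν : IsMarkovMeasure ν q V) :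
    Rint μ ν
        = (1 / matEnt πX W) * sSup {h : ℝ | ∃ ξ : Fin r, 0 < wgt c q ξ ∧ h = matEnt (πY ξ) V}
    ∧ Rstar μ ν
        = (1 / matEnt πX W) * sSup {h : ℝ | ∃ ξ : Fin r, 0 < wgt c q ξ ∧ h = matEnt (πY ξ) V} := by
  have hX : IsBlockChain W (fun _ : 𝒳 => ()) (fun _ => πX) :=
    ⟨hW, fun _ _ h => absurd rfl h, fun x x' _ => hWirr x x', fun _ => hπX,
      fun _ _ h => absurd rfl h⟩
  have hY : IsBlockChain V c πY :=
    ⟨hV, hblock, fun y y' h => hVirr _ y y' rfl h.symm, hπY, hsupp⟩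
  have hXe : HasEquipartition μ (matEnt πX W) :=
    fun δ hδ => hX.tendsto_measureReal_atypical hp hμ hδ
  have hwgt : ∀ ξ, 0 < wgt c q ξ ↔ ∃ y, c y = ξ ∧ 0 < q y := by
    intro ξ
    rw [wgt, Finset.sum_pos_iff_of_nonneg fun y _ => hq.1 y]
    simp
  have hne : ∃ y, 0 < q y := by
    by_contra! h
    have h1 : ∑ y, q y ≤ 0 := Finset.sum_nonpos fun y _ => h y
    linarith [hq.2]
  obtain ⟨y₀, hy₀, hmax⟩ := Finset.exists_max_image (Finset.univ.filter fun y => 0 < q y)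
    (fun y => matEnt (πY (c y)) V) (hne.imp fun y hy => by simpa using hy)
  have hqy₀ : 0 < q y₀ := (Finset.mem_filter.1 hy₀).2
  set M := matEnt (πY (c y₀)) V with hMdef
  have hmax' : ∀ y, 0 < q y → matEnt (πY (c y)) V ≤ M := fun y hy => hmax y (by simpa using hy)
  have hM : 0 ≤ M := matEnt_nonneg hV (hπY _)
  have hsup : sSup {h : ℝ | ∃ ξ : Fin r, 0 < wgt c q ξ ∧ h = matEnt (πY ξ) V} = M := by
    refine IsGreatest.csSup_eq ⟨⟨c y₀, (hwgt _).2 ⟨y₀, rfl, hqy₀⟩, rfl⟩, ?_⟩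
    rintro _ ⟨ξ, hξ, rfl⟩
    obtain ⟨y, rfl, hy⟩ := (hwgt ξ).1 hξ
    exact hmax' y hy
  rw [hsup, one_div_mul_eq_div]
  have hdirect : ∀ R, M / matEnt πX W < R → IntAchievable μ ν R := fun R hR =>
    intAchievable_of_lt hXe hpos hM (fun δ hδ => hY.tendsto_cylP_lt hq hν hmax' hδ) hR
  have hvalid : ∀ R, IntAchievable μ ν R → Achievable μ ν R := fun R hR =>
    hR.achievable hXe hpos
  have hconv : ∀ R, Achievable μ ν R → M / matEnt πX W ≤ R := fun R hR =>
    le_of_achievable hXe hpos (fun δ hδ => hY.eventually_le_cylP_le hq hν hqy₀ hδ) hR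
  exact ⟨csInf_eq_of_Ioi_subset hdirect fun R hR => hconv R (hvalid R hR),
    csInf_eq_of_Ioi_subset (fun R hR => hvalid R (hdirect R hR)) hconv⟩
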